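/- arXiv:math/0302302 — 2 statements merged into one kernel-verified Lean document; each statement's English description precedes it below -/
import Mathlib

section
/- For every δ > 0, limsup_{n→∞} (1/n) log #{ w : w is a ternary square-free word of length n with |count_x(w) − n/3| ≤ δn for each of the three letters x } ≥ (log 39)/42. In particular, the number of ternary square-free words with all three letter frequencies approximately equal to 1/3 grows at least as 39^{n/42}. -/
/-- A word `w` is square-free if whenever `w = x ++ y ++ y ++ z`,
then `y` is the empty word. -/
def SquareFree {α : Type*} (w : List α) : Prop :=
  ∀ x y z : List α, w = x ++ y ++ y ++ z → y = []

def wds0 : List ℕ := [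
  31178223571044760278422664807972,
  31177682232723899934756361766436,
  31178223571044750303653177624100,
  31177682232671802294266939868708,
  31177682216730572835219686327844,
  31177682232723860048047918843428,
  31178223656708997395217283057188,
  31177682216701543584082761647652,
  31178223570528485517211686176292,
  31178223569695828492906037282340,
  31178223569695831659499525277220,
  31177682057322979382929920394788,
  31178223571044904270486913189412,
  31177682232671956261100675434020,
  31177682232723837728807983547940,
  31177682057322971703940712007204,
  31178223569685609816555440604708,
  31177682232671796664788880492068,
  31178223569694853736265595258404,
  31178223569695471855314451858980,
  31177682232671801814207506449956,
  31178223569695831663203733243428,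
  31178223656711672545758803166756,
  31178223656088740274800450373156,
  31177682216699115874771494274596,
  31177682232723898659750021465636,
  31177682232723898539765815084580,
  31177682216730571427859633833508,
  31178223656708996443171008579108,
  31177682057321673835185961207332,
  31178223570525818545374121723428,
  31178223569695471867677313893924,
  31178223570528402525242744145444,
  31178223656090166775744347317796,
  31178223656090179442118299297316,
  31178223571044760273407833089572,
  31178223656090159057791195620900,
  31178223570528485508395808400932,
  31178223571031796877073609467428,
  31178223656711673819837241566756,
  31178223656708997415021188294180,
  31178223571044912010099395995172,
  31178223569685617556167923410468,
  31177682232723898659769361180196,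
  31178223570528485517636698973732,
  31178223569695828493331050079780,
  31177682216730568935423552333348,
  31178223569694855478317026453028,
  31177682216730077480114215527972,
  31178223570525818586212830619172,
  31178223570528485517211497211428,
  31178223656088851685708807611940,
  31178223569695831659499336312356,
  31178223571044904270486724224548,
  31177682232723837728807794583076,
  31178223569685609816555251639844,
  31178223569694853736265406293540,
  31178223571044760278422664586788,
  31178223656711673820765143246372,
  31177682232723899934756361545252,
  31178223571044750303653177402916,
  31177682232671802294266939647524,
  31177682057322979384176076727844,
  31178223571044759954234854155812,
  31178223571031774387659284751908,
  31177682232671796745199874024996,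
  31177682216366856567876673414692,
  31177682232671963347599761155620,
  31177682216730085357836660450852,
  31177682232723837848801395680804,
  31177682216701543584091967399460,
  31177682232723898650488741635620,
  31177682216730571538582560384548,
  31177682232671956384186464020004,
  31178223569685609939641229190692,
  31177682216701543587184343852580,
  31178223656709118309413548533284,
  31177682216701533612414856668708,
  31177682216701533132478031144484,
  31177682057259406574378735445540,
  31178223569685609618034078066212,
  31177682216366907798865055393316,
  31177682216701421668387253724708,
  31177682216361598054904385578532,
  31177682232671796664179610953252,
  31178223569694853735656325719588,
  31178223656088738295254062016036,
  31178223570528395559548562777636,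
  31178223571044904270467127911972,
  31177682232671956261080890156580,
  31177682232723837728788198270500,
  31177682057322971703920926729764,
  31178223569685609816535655327268,
  31178223569695471855294666581540,
  31177682226820941831170994808356,
  31178223656090179597924830881316,
  31177682232723899927218387232292,
  31177682216730572815312205981220,
  31178223571044750296115203089956,
  31177682232671802286728965334564,
  31178223570528485517211379246628,
  31178223569695828492905730352676,
  31178223571044759926542129767972,
  31177682216730568934940250547748,
  31177682216699115795142695003684,
  31178223569694855477833724667428,
  31177682232671796664730591503908,
  31178223569685125961012185998884,
  31177682226820941831132491097636,
  31178223569694853587773236520484,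
  31178223656088738295252401071652,
  31177682216364890507877212038692]

def wds1 : List ℕ := [
  123128176418809686700078886623305,
  123128331376436614908948645484617,
  123128176418809665958891540256841,
  123128331376551186483468950902857,
  123128331405766937958933919766601,
  123128331376436531916986347231305,
  123128176289307848226383304661065,
  123128331405780073216398338889801,
  123128176419178153264375025702985,
  123128176418176719340434040100937,
  123128176418176712373928366512201,
  123128331033894358796088010938441,
  123128176418809182384890141284425,
  123128331376550702909467551930441,
  123128331376436563680511474079817,
  123128331033894361289780382734409,
  123128176418155475891778059049033,
  123128331376551194364776888735817,
  123128176418178503359622757816393,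
  123128176418176567937682895345737,
  123128331376551186807630936479817,
  123128176418176712377024366843977,
  123128176289313076920397712660553,
  123128176291388842283648116398153,
  123128331405788183932699287296073,
  123128331376436614279834049779785,
  123128331376436614318797993089097,
  123128331405766937395996180158537,
  123128176289307847435769348692041,
  123128331033893714433074612738121,
  123128176419172894752437153896521,
  123128176418176567910473606436937,
  123128176419178113377670206658633,
  123128176291389448003559925106761,
  123128176291389420137537230751817,
  123128176418809686707637101938761,
  123128176291389450617236503283785,
  123128176419178153295151834220617,
  123128176418838217706633041430601,
  123128176289313075015464838907977,
  123128176289307848236253554559049,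
  123128176418809179780465337714761,
  123128176418155473287353255479369,
  123128331376436614279805071149129,
  123128176419178153264143512520777,
  123128176418176719340202526918729,
  123128331405766945075574885206089,
  123128176418178502567742872635465,
  123128331405767104671886680148041,
  123128176419172894832191487756361,
  123128176419178153264375440754761,
  123128176291388781590809212766281,
  123128176418176712373928781563977,
  123128176418809182384890556336201,
  123128331376436563680511889131593,
  123128176418155475891778474100809,
  123128176418178503359623172868169,
  123128176418809686700078886438985,
  123128176289313075016237517785161,
  123128331376436614908948645300297,
  123128176418809665958891540072521,
  123128331376551186483468950718537,
  123128331033894358794203742488649,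
  123128176418809686544271580219465,
  123128176418838208685136647702601,
  123128331376551194402475038885961,
  123128331406286030798203643906121,
  123128331376550699028506260686921,
  123128331405767099049530483689545,
  123128331376436563599462368430153,
  123128331405780073216369496311881,
  123128331376436614258154948151369,
  123128331405766937335353135220809,
  123128331376550702821615218083913,
  123128176418155475803925725202505,
  123128331405780073209566268115017,
  123128176289307765835343987886153,
  123128331405780052468378921748553,
  123128331405780052792459974035529,
  123128331033841810798768105343049,
  123128176418155475653017754290249,
  123128331406285917368804551313481,
  123128331405780113591054943537225,
  123128331406283363827815832242249,
  123128331376551194363511095576649,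
  123128176418178503358356964657225,
  123128176291388843669225786722377,
  123128176419178117178393886869577,
  123128176418809182384880626059337,
  123128331376550702909458036705353,
  123128331376436563680501958854729,
  123128331033894361289770867509321,
  123128176418155475891768543823945,
  123128176418176567937673380120649,
  123128331374075431667512897587273,
  123128176291389419657541653252169,
  123128331376436614911500306499657,
  123128331405766937988698493569097,
  123128176418809665961443201271881,
  123128331376551186486020611917897,
  123128176419178153264375476144201,
  123128176418176719340434490542153,
  123128176418809686559456739084361,
  123128331405766945075913149270089,
  123128331405788184051755828529225,
  123128176418178502568081136699465,
  123128331376551194364883639617609,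
  123128176418155805217607561398345,
  123128331374075431667629163694153,
  123128176418178503854509741197385,
  123128176291388843669226692692041,
  123128331406287358671476075153481]

def wds2 : List ℕ := [
  170212153668572279804654469144978,
  170212540049266211939451013325202,
  170212153668572310520611302695314,
  170212540049203738005420129804690,
  170212540035929215989002414481810,
  170212540049266334818121754501522,
  170212153712409881161555432858002,
  170212540035945109982674920038802,
  170212153668720088001569308696978,
  170212153670554178949815943192978,
  170212153670554182749728128786834,
  170212540567209388604138089243026,
  170212153668572640127778966102418,
  170212540049204067612587793211794,
  170212540049266325373836562948498,
  170212540567209393789434925834642,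
  170212153670585641074822520922514,
  170212540049203735753590251348370,
  170212153670553369687267667501458,
  170212153670554686990158673371538,
  170212540049203738161317577646482,
  170212153670554182742927920488850,
  170212153712401977316999504748946,
  170212153710949144224707453804946,
  170212540035939426975685239005586,
  170212540049266213843571949330834,
  170212540049266213924592212402578,
  170212540035929217959300206584210,
  170212153712409882904215663305106,
  170212540567211338514895446630802,
  170212153668728013485344744956306,
  170212153670554687005005100245394,
  170212153668720210880243069772178,
  170212153710947112003851748151698,
  170212153710947127203500490527122,
  170212153668572279802111085547922,
  170212153710947117108128321671570,
  170212153668720087979608377954706,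
  170212153668556712199449369678226,
  170212153712401977947853940101522,
  170212153712409881131881277723026,
  170212153668572634992591286866322,
  170212153670585635939634841686418,
  170212540049266213843581588246930,
  170212153668720088001375809081746,
  170212153670554178949622443577746,
  170212540035929212772157583036818,
  170212153670553368737096121487762,
  170212540035929544631155124900242,
  170212153668728013364751702200722,
  170212153668720088001569082610066,
  170212153710949093506638000198034,
  170212153670554182749727902699922,
  170212153668572640127778740015506,
  170212540049266325373836336861586,
  170212153670585641074822294835602,
  170212153670553369687267441414546,
  170212153668572279804654469550482,
  170212153712401977946153359544722,
  170212540049266211939451013730706,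
  170212153668572310520611303100818,
  170212540049203738005420130210194,
  170212540567209388604776201359762,
  170212153668572280284649586200978,
  170212153668556743710360088121746,
  170212540049203735635481107665298,
  170212540035773839417075703255442,
  170212540049204064407049998733714,
  170212540035929542375788876435858,
  170212540049266325334892256465298,
  170212540035945109982694556864914,
  170212540049266213874512330789266,
  170212540035929217909220324970898,
  170212540049204067577354338472338,
  170212153670585641039589066183058,
  170212540035945109986405408608658,
  170212153712409842638398484156818,
  170212540035945140702362242158994,
  170212540035945140858218015396242,
  170212540567325509410009179787666,
  170212153670585641512104188219794,
  170212540035773901615486413869458,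
  170212540035945191523713823314322,
  170212540035781764900435802755474,
  170212540049203735755465314046354,
  170212153670553369689142730199442,
  170212153710949144818676171837842,
  170212153668720214045213570929042,
  170212153668572640127808266604946,
  170212540049204067612617093714322,
  170212540049266325373865863451026,
  170212540567209393789464226337170,
  170212153670585641074851821425042,
  170212153670554686990187973874066,
  170212540057530353284472128180626,
  170212153710947127527689536442770,
  170212540049266211944437326844306,
  170212540035929215979145321025938,
  170212153668572310525597616214418,
  170212540049203738010406443323794,
  170212153668720088001569165185426,
  170212153670554178949815799681426,
  170212153668572280297157151723922,
  170212540035929212772302620758418,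
  170212540035939426936257497043346,
  170212153670553368737241159209362,
  170212540049203735753541789454738,
  170212153670585795604536273179026,
  170212540057530353284394365784466,
  170212153670553369340873042858386,
  170212153710949144818676926812562,
  170212540035774477603802733384082]

def pre : ℕ → ℕ
  | 0 => 548
  | 1 => 73
  | _ => 402

def suf : ℕ → ℕ
  | 0 => 1574
  | 1 => 6216
  | _ => 8593

def wds : ℕ → List ℕ
  | 0 => wds0
  | 1 => wds1
  | _ => wds2

def sqTab : List (ℕ × List ℕ × ℕ) := [
  (1, [1], 453709822561251284617832809909024281941),
  (2, [1, 2], 28356863910078205288614550619314017621),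
  (3, [1, 2, 2], 1772303994379887830538409413707126101),
  (4, [1, 2, 4], 110768999648742989408650588356695381),
  (5, [1, 2, 4, 2], 6923062478046436838040661772293461),
  (6, [1, 2, 4, 4], 432691404877902302377541360768341),
  (7, [1, 2, 4, 6], 27043212804868893898596335048021),
  (8, [1, 2, 4, 8], 1690200800304305868662270940501),
  (9, [1, 2, 4, 8, 2], 105637550019019116791391933781),
  (10, [1, 2, 4, 8, 4], 6602346876188694799461995861),
  (11, [1, 2, 4, 8, 6], 412646679761793424966374741),
  (12, [1, 2, 4, 8, 8], 25790417485112089060398421),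
  (13, [1, 2, 4, 8, 10], 1611901092819505566274901),
  (14, [1, 2, 4, 8, 12], 100743818301219097892181),
  (15, [1, 2, 4, 8, 14], 6296488643826193618261),
  (16, [1, 2, 4, 8, 16], 393530540239137101141),
  (17, [1, 2, 4, 8, 16, 2], 24595658764946068821),
  (18, [1, 2, 4, 8, 16, 4], 1537228672809129301),
  (19, [1, 2, 4, 8, 16, 6], 96076792050570581),
  (20, [1, 2, 4, 8, 16, 8], 6004799503160661),
  (21, [1, 2, 4, 8, 16, 10], 375299968947541),
  (22, [1, 2, 4, 8, 16, 12], 23456248059221),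
  (23, [1, 2, 4, 8, 16, 14], 1466015503701),
  (24, [1, 2, 4, 8, 16, 16], 91625968981),
  (25, [1, 2, 4, 8, 16, 18], 5726623061),
  (26, [1, 2, 4, 8, 16, 20], 357913941),
  (27, [1, 2, 4, 8, 16, 22], 22369621),
  (28, [1, 2, 4, 8, 16, 24], 1398101),
  (29, [1, 2, 4, 8, 16, 26], 87381),
  (30, [1, 2, 4, 8, 16, 28], 5461),
  (31, [1, 2, 4, 8, 16, 30], 341),
  (32, [1, 2, 4, 8, 16, 32], 21),
  (33, [1, 2, 4, 8, 16, 32, 2], 1)]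
/-- Digit `k` of `U` in base `4`. -/
def dg (U k : ℕ) : ℕ := U / 4 ^ k % 4

/-- Bounded universal quantifier, in a form that the kernel evaluates quickly. -/
def allB (n : ℕ) (f : ℕ → Bool) : Bool := Nat.rec true (fun k r => and (f k) r) n

/-- Evaluate `x` before passing it to `f`. -/
def frc (x : ℕ) (f : ℕ → Bool) : Bool := Nat.rec (f 0) (fun n _ => f (Nat.succ n)) x

def orRun (ds : List ℕ) : ℕ → (ℕ → Bool) → Bool :=
  List.rec (fun D k => k D)
    (fun d _ r D k => frc (Nat.lor D (Nat.shiftRight D d)) (fun D' => r D' k)) ds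

/-- No square of period in the table inside the `66` digits of `U`. -/
def sqCheck (U : ℕ) : Bool :=
  sqTab.all (fun e => frc (Nat.xor U (Nat.shiftRight U (Nat.mul 2 e.1)))
    (fun D => orRun e.2.1 D (fun R => Nat.beq (Nat.land R e.2.2) e.2.2)))

/-- No boundary marker at an inner position of the `66` digits of `U`. -/
def mkCheck (U : ℕ) : Bool :=
  allB 53 (fun o => frc (Nat.div U (Nat.pow 4 (Nat.succ o))) (fun V =>
    frc (Nat.mod (Nat.div V 16384) 1024) (fun v =>
      allB 3 (fun z => or (Bool.not (Nat.beq v (pre z)))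
        (allB 3 (fun z' => or (Nat.beq z z') (Bool.not (Nat.beq (Nat.mod V 16384) (suf z')))))))))

def ctx (x b y : ℕ) : ℕ := suf x + 4 ^ 7 * (b + 4 ^ 54 * pre y)

/-- All contexts of the block `b` of type `x` are fine. -/
def ctxCheck (x b : ℕ) : Bool :=
  allB 3 (fun x' => or (Nat.beq x' x) (allB 3 (fun y => or (Nat.beq y x)
    (frc (ctx x' b y) (fun U => and (sqCheck U) (mkCheck U))))))

def maxB (a b : ℕ) : ℕ := cond (Nat.ble a b) b a

/-- `b` of type `x` followed by a block of type `y`, initial condition. -/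
def rCheck (x b : ℕ) : Bool :=
  allB 3 (fun y => or (Nat.beq y x) (frc (b + 4 ^ 54 * pre y) (fun V =>
    allB 53 (fun o => frc (Nat.div V (Nat.pow 4 (Nat.succ o))) (fun T =>
      or (Bool.not (Nat.beq (Nat.mod T 1024) (pre y)))
        (frc (Nat.pow 4 (maxB 5 (46 - o))) (fun h => frc (Nat.mod T h) (fun T' =>
          (wds y).all (fun b' => Bool.not (Nat.beq T' (Nat.mod b' h)))))))))))

/-- `b` of type `y` preceded by a block of type `x`, suffix condition. -/
def lCheck (y b : ℕ) : Bool :=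
  allB 3 (fun x => or (Nat.beq x y) (frc (suf x + 4 ^ 7 * b) (fun V =>
    allB 53 (fun o => or (Bool.not (Nat.beq (Nat.mod (Nat.div V (Nat.pow 4 (Nat.succ o))) 16384) (suf x)))
      (frc (maxB 7 (o - 4)) (fun h => frc (Nat.pow 4 (54 - h)) (fun g =>
        frc (Nat.mod (Nat.div V (Nat.pow 4 (o + 8 - h))) (Nat.pow 4 h)) (fun T' =>
          (wds x).all (fun b' => Bool.not (Nat.beq T' (Nat.div b' g)))))))))))

/-- Basic shape of a block of type `x`. -/
def bsCheck (x b : ℕ) : Bool :=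
  and (Nat.beq (Nat.mod b 1024) (pre x)) (and (Nat.beq (Nat.div b (4 ^ 47)) (suf x))
    (and (allB 54 (fun k => Nat.ble (dg b k) 2))
      (allB 3 (fun d => Nat.beq (((List.range 54).map (dg b)).count d) 18))))

theorem check_ctx : allB 3 (fun x => (wds x).all (fun b => ctxCheck x b)) = true := by
  decide +kernel
theorem check_r : allB 3 (fun x => (wds x).all (fun b => rCheck x b)) = true := by
  decide +kernel
theorem check_l : allB 3 (fun x => (wds x).all (fun b => lCheck x b)) = true := by
  decide +kernel
theorem check_bs : allB 3 (fun x => (wds x).all (fun b => bsCheck x b)) = true := by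
  decide +kernel
theorem check_len : ∀ x < 3, (wds x).length = 112 := by
  decide +kernel
theorem check_nodup : ∀ x < 3, (wds x).Nodup := by
  decide +kernel
theorem check_n1 : ∀ x < 3, ∀ y < 3, ∀ z < 3, ∀ d < 6,
    x = y ∨ (suf x + 4 ^ 7 * pre y) / 4 ^ (6 - d) % 4 ^ 5 ≠ pre z := by
  decide +kernel
theorem check_n2 : ∀ x < 3, ∀ y < 3, ∀ z < 3, ∀ d < 4,
    x = y ∨ (suf x + 4 ^ 7 * pre y) / 4 ^ (d + 1) % 4 ^ 7 ≠ suf z := by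
  decide +kernel
theorem check_tab_sum : ∀ e ∈ sqTab, e.2.1.sum + 1 = 2 * e.1 := by
  decide +kernel
theorem check_tab_mask : ∀ e ∈ sqTab, ∀ i < 67 - 2 * e.1, e.2.2.testBit (2 * i) = true := by
  decide +kernel
theorem check_tab_mem : ∀ p < 33, ∃ e ∈ sqTab, e.1 = p + 1 := by
  decide +kernel
theorem pre_lt (x : ℕ) : pre x < 4 ^ 5 := by
  unfold pre; split <;> norm_num
theorem suf_lt (x : ℕ) : suf x < 4 ^ 7 := by
  unfold suf; split <;> norm_num
theorem pre_inj : ∀ x < 3, ∀ y < 3, dg (pre x) 0 = dg (pre y) 0 → x = y := by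
  decide +kernel

theorem allB_spec {n : ℕ} {f : ℕ → Bool} (h : allB n f = true) : ∀ k < n, f k = true := by
  induction n with
  | zero => intro k hk; omega
  | succ n ih =>
    have h' : (f n && allB n f) = true := h
    rw [Bool.and_eq_true] at h'
    intro k hk
    rcases Nat.lt_succ_iff_lt_or_eq.mp hk with h1 | h1
    · exact ih h'.2 k h1
    · rw [h1]; exact h'.1

theorem frc_eq (x : ℕ) (f : ℕ → Bool) : frc x f = f x := by
  cases x <;> rfl

theorem maxB_eq (a b : ℕ) : maxB a b = max a b := by
  unfold maxB
  by_cases h : a ≤ b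
  · simp [Nat.ble_eq.mpr h, h]
  · have : Nat.ble a b = false := by
      rw [← Bool.not_eq_true, Nat.ble_eq]; exact h
    rw [this]; simp; omega

theorem nbeq {a b : ℕ} (h : Nat.beq a b = true) : a = b := Nat.eq_of_beq_eq_true h
theorem nbeq_self (a : ℕ) : Nat.beq a a = true := Nat.beq_refl a
theorem nnbeq {a b : ℕ} (h : (Bool.not (Nat.beq a b)) = true) : a ≠ b := by
  rintro rfl; rw [nbeq_self] at h; exact absurd h (by decide)
theorem or_beq {a b : ℕ} {r : Bool} (h : or (Nat.beq a b) r = true) (hn : a ≠ b) : r = true := by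
  rcases (Bool.or_eq_true _ _).mp h with h | h
  · exact absurd (nbeq h) hn
  · exact h
theorem or_nbeq {a b : ℕ} {r : Bool} (h : or (Bool.not (Nat.beq a b)) r = true) (hn : a = b) :
    r = true := by
  rcases (Bool.or_eq_true _ _).mp h with h | h
  · exact absurd hn (nnbeq h)
  · exact h

theorem orRun_eq (ds : List ℕ) (D : ℕ) (k : ℕ → Bool) :
    orRun ds D k = k (ds.foldl (fun R d => R ||| R >>> d) D) := by
  induction ds generalizing D with
  | nil => rfl
  | cons d ds ih =>
    have : orRun (d :: ds) D k = frc (Nat.lor D (Nat.shiftRight D d)) (fun D' => orRun ds D' k) := rfl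
    rw [this, frc_eq, ih]; rfl

theorem run_zero (ds : List ℕ) (D i : ℕ) (h : ∀ j < ds.sum + 1, D.testBit (i + j) = false) :
    (ds.foldl (fun R d => R ||| R >>> d) D).testBit i = false := by
  induction ds generalizing D with
  | nil => simpa using h 0 (by simp)
  | cons d ds ih =>
    rw [List.foldl_cons]
    apply ih
    intro j hj
    rw [List.sum_cons] at h
    rw [Nat.testBit_or, Nat.testBit_shiftRight, h j (by omega)]
    have := h (d + j) (by omega)
    rw [show d + (i + j) = i + (d + j) by ring, this]; rfl

theorem dg_div (U n k : ℕ) : dg (U / 4 ^ n) k = dg U (n + k) := by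
  unfold dg; rw [Nat.div_div_eq_div_mul, ← pow_add]

theorem dg_testBit (U k b : ℕ) (hb : b < 2) : U.testBit (2 * k + b) = (dg U k).testBit b := by
  unfold dg
  rw [show (4 : ℕ) = 2 ^ 2 by norm_num, ← pow_mul, Nat.testBit_mod_two_pow,
    Nat.testBit_div_two_pow]
  simp [hb, add_comm]

theorem window_eq_aux (U V h : ℕ) (H : ∀ k < h, dg U k = dg V k) : U % 4 ^ h = V % 4 ^ h := by
  induction h with
  | zero => simp [Nat.mod_one]
  | succ h ih =>
    rw [Nat.mod_pow_succ, Nat.mod_pow_succ, ih (fun k hk => H k (by omega))]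
    have := H h (by omega)
    unfold dg at this
    rw [this]

theorem window_eq (U V a b h : ℕ) (H : ∀ k < h, dg U (a + k) = dg V (b + k)) :
    U / 4 ^ a % 4 ^ h = V / 4 ^ b % 4 ^ h := by
  apply window_eq_aux
  intro k hk
  rw [dg_div, dg_div]; exact H k hk

theorem dg_mod (U n k : ℕ) (h : k < n) : dg (U % 4 ^ n) k = dg U k := by
  unfold dg
  obtain ⟨m, rfl⟩ : ∃ m, n = k + 1 + m := ⟨n - (k + 1), by omega⟩
  rw [show 4 ^ (k + 1 + m) = 4 ^ k * (4 * 4 ^ m) by ring, Nat.mod_mul_right_div_self,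
    Nat.mod_mul_right_mod]

theorem dg_add_lo (a n b k : ℕ) (ha : a < 4 ^ n) (h : k < n) : dg (a + 4 ^ n * b) k = dg a k := by
  rw [← dg_mod _ n k h, Nat.add_mul_mod_self_left, Nat.mod_eq_of_lt ha]

theorem dg_add_hi (a n b k : ℕ) (ha : a < 4 ^ n) : dg (a + 4 ^ n * b) (n + k) = dg b k := by
  rw [← dg_div, Nat.add_mul_div_left _ _ (by positivity), Nat.div_eq_of_lt ha, zero_add]

theorem sqCheck_spec {U : ℕ} (h : sqCheck U = true) (i p : ℕ) (hp : 0 < p) (hip : i + 2 * p ≤ 66)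
    (H : ∀ k < p, dg U (i + k) = dg U (i + k + p)) : False := by
  obtain ⟨e, he, hep⟩ := check_tab_mem (p - 1) (by omega)
  have h1 := List.all_eq_true.mp h e he
  simp only [frc_eq, orRun_eq] at h1
  have h2 := nbeq h1
  have hs := check_tab_sum e he
  have hm := check_tab_mask e he i (by omega)
  have hep' : e.1 = p := by omega
  have hz := run_zero e.2.1 (Nat.xor U (Nat.shiftRight U (Nat.mul 2 e.1))) (2 * i) (by
    intro j hj
    rw [hs] at hj
    change (U ^^^ U >>> (2 * e.1)).testBit (2 * i + j) = false
    rw [Nat.testBit_xor, Nat.testBit_shiftRight, hep']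
    have hk := H (j / 2) (by omega)
    have e1 : 2 * i + j = 2 * (i + j / 2) + j % 2 := by omega
    have e2 : 2 * p + (2 * i + j) = 2 * (i + j / 2 + p) + j % 2 := by omega
    rw [e2, e1, dg_testBit _ _ _ (Nat.mod_lt _ (by norm_num)),
      dg_testBit _ _ _ (Nat.mod_lt _ (by norm_num)), hk]
    simp)
  rw [← h2] at hm
  change ((_ : ℕ) &&& _).testBit _ = true at hm
  rw [Nat.testBit_and, hz] at hm
  exact absurd hm (by simp)

theorem mkCheck_spec {U : ℕ} (h : mkCheck U = true) (o : ℕ) (ho : o < 53) (z z' : ℕ) (hz : z < 3)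
    (hz' : z' < 3) (hne : z ≠ z') (h1 : U / 4 ^ (o + 1 + 7) % 4 ^ 5 = pre z)
    (h2 : U / 4 ^ (o + 1) % 4 ^ 7 = suf z') : False := by
  have h3 := allB_spec h o ho
  simp only [frc_eq] at h3
  have h4 := allB_spec h3 z hz
  have e1 : Nat.mod (Nat.div (Nat.div U (Nat.pow 4 (Nat.succ o))) 16384) 1024 = pre z := by
    rw [← h1]
    change U / 4 ^ (o + 1) / 4 ^ 7 % 4 ^ 5 = _
    rw [Nat.div_div_eq_div_mul, ← pow_add]
  have h5 := allB_spec (or_nbeq h4 e1) z' hz'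
  exact nnbeq (or_beq h5 hne) h2

theorem ctx_spec {x b : ℕ} (hx : x < 3) (hb : b ∈ wds x) {x' y : ℕ} (hx' : x' < 3) (hy : y < 3)
    (h1 : x' ≠ x) (h2 : y ≠ x) :
    sqCheck (ctx x' b y) = true ∧ mkCheck (ctx x' b y) = true := by
  have h := List.all_eq_true.mp (allB_spec check_ctx x hx) b hb
  have h3 := or_beq (allB_spec (or_beq (allB_spec h x' hx') h1) y hy) h2
  rw [frc_eq] at h3
  exact (Bool.and_eq_true _ _).mp h3

theorem r_spec {x b : ℕ} (hx : x < 3) (hb : b ∈ wds x) {y b' : ℕ} (hy : y < 3) (hb' : b' ∈ wds y)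
    (hne : y ≠ x) (o : ℕ) (ho : o < 53)
    (h1 : (b + 4 ^ 54 * pre y) / 4 ^ (o + 1) % 4 ^ 5 = pre y)
    (h2 : (b + 4 ^ 54 * pre y) / 4 ^ (o + 1) % 4 ^ (max 5 (46 - o)) = b' % 4 ^ (max 5 (46 - o))) :
    False := by
  have h := List.all_eq_true.mp (allB_spec check_r x hx) b hb
  have h3 := or_beq (allB_spec h y hy) hne
  rw [frc_eq] at h3
  have h4 := allB_spec h3 o ho
  rw [frc_eq] at h4
  have h5 := or_nbeq h4 h1
  simp only [frc_eq, maxB_eq] at h5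
  exact nnbeq (List.all_eq_true.mp h5 b' hb') h2

theorem l_spec {y b : ℕ} (hy : y < 3) (hb : b ∈ wds y) {x b' : ℕ} (hx : x < 3) (hb' : b' ∈ wds x)
    (hne : x ≠ y) (o : ℕ) (ho : o < 53)
    (h1 : (suf x + 4 ^ 7 * b) / 4 ^ (o + 1) % 4 ^ 7 = suf x)
    (h2 : (suf x + 4 ^ 7 * b) / 4 ^ (o + 8 - max 7 (o - 4)) % 4 ^ (max 7 (o - 4)) =
      b' / 4 ^ (54 - max 7 (o - 4))) :
    False := by
  have h := List.all_eq_true.mp (allB_spec check_l y hy) b hb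
  have h3 := or_beq (allB_spec h x hx) hne
  rw [frc_eq] at h3
  have h4 := allB_spec h3 o ho
  have h5 := or_nbeq h4 h1
  simp only [frc_eq, maxB_eq] at h5
  exact nnbeq (List.all_eq_true.mp h5 b' hb') h2

theorem bs_spec {x b : ℕ} (hx : x < 3) (hb : b ∈ wds x) :
    b % 4 ^ 5 = pre x ∧ b / 4 ^ 47 = suf x ∧ (∀ k < 54, dg b k < 3) ∧
      ∀ d < 3, ((List.range 54).map (dg b)).count d = 18 := by
  have h := List.all_eq_true.mp (allB_spec check_bs x hx) b hb
  obtain ⟨h1, h⟩ := (Bool.and_eq_true _ _).mp h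
  obtain ⟨h2, h⟩ := (Bool.and_eq_true _ _).mp h
  obtain ⟨h3, h⟩ := (Bool.and_eq_true _ _).mp h
  exact ⟨nbeq h1, nbeq h2, fun k hk => Nat.lt_succ_of_le (Nat.le_of_ble_eq_true (allB_spec h3 k hk)),
    fun d hd => nbeq (allB_spec h d hd)⟩

theorem wds_lt {x b : ℕ} (hx : x < 3) (hb : b ∈ wds x) : b < 4 ^ 54 := by
  have h := (bs_spec hx hb).2.1
  have h2 := suf_lt x
  rw [← h, Nat.div_lt_iff_lt_mul (by positivity), ← pow_add] at h2
  exact h2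
/-- Block number `j` of the coded word. -/
def blk (w f : ℕ → ℕ) (j : ℕ) : ℕ := (wds (w j)).getD (f j) 0

/-- The infinite word obtained by concatenating the blocks. -/
def Wd (w f : ℕ → ℕ) (n : ℕ) : ℕ := dg (blk w f (n / 54)) (n % 54)

structure Good (w f : ℕ → ℕ) : Prop where
  lt : ∀ n, w n < 3
  ne : ∀ n, w n ≠ w (n + 1)
  flt : ∀ n, f n < 112

namespace Good

theorem mem {w f : ℕ → ℕ} (g : Good w f) (j : ℕ) : blk w f j ∈ wds (w j) := by
  unfold blk
  have h : f j < (wds (w j)).length := by rw [check_len _ (g.lt j)]; exact g.flt j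
  rw [List.getD_eq_getElem _ _ h]
  exact List.getElem_mem h

theorem blk_lt {w f : ℕ → ℕ} (g : Good w f) (j : ℕ) : blk w f j < 4 ^ 54 := wds_lt (g.lt j) (g.mem j)

theorem Wd_eq {w f : ℕ → ℕ} (j k : ℕ) (hk : k < 54) : Wd w f (54 * j + k) = dg (blk w f j) k := by
  unfold Wd
  rw [show (54 * j + k) / 54 = j by omega, show (54 * j + k) % 54 = k by omega]

theorem Wd_pre {w f : ℕ → ℕ} (g : Good w f) (j k : ℕ) (hk : k < 5) : Wd w f (54 * j + k) = dg (pre (w j)) k := by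
  rw [Wd_eq j k (by omega), ← (bs_spec (g.lt j) (g.mem j)).1, dg_mod _ _ _ hk]

theorem Wd_suf {w f : ℕ → ℕ} (g : Good w f) (j k : ℕ) (hk : k < 7) : Wd w f (54 * j + 47 + k) = dg (suf (w j)) k := by
  rw [add_assoc, Wd_eq j _ (by omega), ← (bs_spec (g.lt j) (g.mem j)).2.1, dg_div]

theorem Wd_bpre {w f : ℕ → ℕ} (g : Good w f) (j k : ℕ) (hk : k < 59) :
    Wd w f (54 * j + k) = dg (blk w f j + 4 ^ 54 * pre (w (j + 1))) k := by
  by_cases h : k < 54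
  · rw [Wd_eq j k h, dg_add_lo _ _ _ _ (g.blk_lt j) h]
  · obtain ⟨r, rfl⟩ : ∃ r, k = 54 + r := ⟨k - 54, by omega⟩
    rw [dg_add_hi _ _ _ _ (g.blk_lt j), ← g.Wd_pre _ _ (by omega)]
    congr 1; ring

theorem Wd_ctx {w f : ℕ → ℕ} (g : Good w f) (j k : ℕ) (hk : k < 66) :
    Wd w f (54 * j + 47 + k) = dg (ctx (w j) (blk w f (j + 1)) (w (j + 2))) k := by
  unfold ctx
  by_cases h : k < 7
  · rw [g.Wd_suf j k h, dg_add_lo _ _ _ _ (suf_lt _) h]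
  · obtain ⟨r, rfl⟩ : ∃ r, k = 7 + r := ⟨k - 7, by omega⟩
    rw [dg_add_hi _ _ _ _ (suf_lt _), ← g.Wd_bpre (j + 1) _ (by omega)]
    congr 1; ring

theorem Wd_sufb {w f : ℕ → ℕ} (g : Good w f) (j k : ℕ) (hk : k < 61) :
    Wd w f (54 * j + 47 + k) = dg (suf (w j) + 4 ^ 7 * blk w f (j + 1)) k := by
  by_cases h : k < 7
  · rw [g.Wd_suf j k h, dg_add_lo _ _ _ _ (suf_lt _) h]
  · obtain ⟨r, rfl⟩ : ∃ r, k = 7 + r := ⟨k - 7, by omega⟩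
    rw [dg_add_hi _ _ _ _ (suf_lt _), ← Wd_eq (j + 1) _ (by omega)]
    congr 1; ring

theorem Wd_sufpre {w f : ℕ → ℕ} (g : Good w f) (j k : ℕ) (hk : k < 12) :
    Wd w f (54 * j + 47 + k) = dg (suf (w j) + 4 ^ 7 * pre (w (j + 1))) k := by
  by_cases h : k < 7
  · rw [g.Wd_suf j k h, dg_add_lo _ _ _ _ (suf_lt _) h]
  · obtain ⟨r, rfl⟩ : ∃ r, k = 7 + r := ⟨k - 7, by omega⟩
    rw [dg_add_hi _ _ _ _ (suf_lt _), ← g.Wd_pre (j + 1) _ (by omega)]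
    congr 1; ring

/-- No squares inside a block with its context. -/
theorem F1 {w f : ℕ → ℕ} (g : Good w f) (j i p : ℕ) (h1 : 54 * j + 47 ≤ i) (hp : 0 < p) (h2 : i + 2 * p ≤ 54 * j + 113)
    (H : ∀ n, i ≤ n → n < i + p → Wd w f n = Wd w f (n + p)) : False := by
  have hc := (ctx_spec (g.lt (j + 1)) (g.mem (j + 1)) (g.lt j) (g.lt (j + 2)) (g.ne j)
    (g.ne (j + 1)).symm).1
  apply sqCheck_spec hc (i - (54 * j + 47)) p hp (by omega)
  intro k hk
  rw [← g.Wd_ctx j _ (by omega), ← g.Wd_ctx j _ (by omega)]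
  have := H (i + k) (by omega) (by omega)
  convert this using 2 <;> omega

/-- The boundary markers occur only at boundaries. -/
theorem F2 {w f : ℕ → ℕ} (g : Good w f) (j u : ℕ) (hu : 54 ≤ u) (hu' : u % 54 ≠ 0)
    (H : ∀ k < 12, Wd w f (54 * j + 47 + k) = Wd w f (u - 7 + k)) : False := by
  obtain ⟨m, hm⟩ : ∃ m, u / 54 = m + 1 := ⟨u / 54 - 1, by omega⟩
  have hc := (ctx_spec (g.lt (m + 1)) (g.mem (m + 1)) (g.lt m) (g.lt (m + 2)) (g.ne m)
    (g.ne (m + 1)).symm).2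
  have hup : u = 54 * (m + 1) + u % 54 := by omega
  apply mkCheck_spec hc (u % 54 - 1) (by omega) (w (j + 1)) (w j) (g.lt _) (g.lt _) (g.ne j).symm
  · have := window_eq (ctx (w m) (blk w f (m + 1)) (w (m + 2))) (pre (w (j + 1)))
      (u % 54 - 1 + 1 + 7) 0 5 (by
        intro k hk
        rw [← g.Wd_ctx m _ (by omega), zero_add, ← g.Wd_pre (j + 1) k hk]
        have := H (7 + k) (by omega)
        rw [show 54 * (j + 1) + k = 54 * j + 47 + (7 + k) by ring, this]
        congr 1; omega)
    rw [this, pow_zero, Nat.div_one, Nat.mod_eq_of_lt (pre_lt _)]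
  · have := window_eq (ctx (w m) (blk w f (m + 1)) (w (m + 2))) (suf (w j))
      (u % 54 - 1 + 1) 0 7 (by
        intro k hk
        rw [← g.Wd_ctx m _ (by omega), zero_add, ← g.Wd_suf j k hk]
        have := H k (by omega)
        rw [this]
        congr 1; omega)
    rw [this, pow_zero, Nat.div_one, Nat.mod_eq_of_lt (suf_lt _)]

theorem FR {w f : ℕ → ℕ} (g : Good w f) (j p : ℕ) (hp : 0 < p) (hp' : p < 54)
    (H : ∀ k < max 5 (p - 7), Wd w f (54 * (j + 1) + k) = Wd w f (54 * (j + 1) - p + k)) :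
    False := by
  have e46 : 46 - (53 - p) = p - 7 := by omega
  apply r_spec (g.lt j) (g.mem j) (g.lt (j + 1)) (g.mem (j + 1)) (g.ne j).symm (53 - p) (by omega)
  · have := window_eq (blk w f j + 4 ^ 54 * pre (w (j + 1))) (pre (w (j + 1)))
      (53 - p + 1) 0 5 (by
        intro k hk
        rw [← g.Wd_bpre j _ (by omega), zero_add, ← g.Wd_pre (j + 1) k hk,
          H k (by omega)]
        congr 1; omega)
    rw [this, pow_zero, Nat.div_one, Nat.mod_eq_of_lt (pre_lt _)]
  · rw [e46]
    have := window_eq (blk w f j + 4 ^ 54 * pre (w (j + 1))) (blk w f (j + 1))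
      (53 - p + 1) 0 (max 5 (p - 7)) (by
        intro k hk
        rw [← g.Wd_bpre j _ (by omega), zero_add, ← Wd_eq (j + 1) k (by omega), H k hk]
        congr 1; omega)
    rw [this, pow_zero, Nat.div_one]

theorem FL {w f : ℕ → ℕ} (g : Good w f) (j p : ℕ) (hp : 0 < p) (hp' : p < 54)
    (H : ∀ k < max 7 (p - 5), Wd w f (54 * (j + 1) - max 7 (p - 5) + k) =
      Wd w f (54 * (j + 1) - max 7 (p - 5) + k + p)) :
    False := by
  have e4 : p - 1 - 4 = p - 5 := by omega
  apply l_spec (g.lt (j + 1)) (g.mem (j + 1)) (g.lt j) (g.mem j) (g.ne j) (p - 1) (by omega)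
  · have := window_eq (suf (w j) + 4 ^ 7 * blk w f (j + 1)) (suf (w j)) (p - 1 + 1) 0 7 (by
        intro k hk
        rw [← g.Wd_sufb j _ (by omega), zero_add, ← g.Wd_suf j k hk]
        have := H (max 7 (p - 5) - 7 + k) (by omega)
        rw [show 54 * j + 47 + k = 54 * (j + 1) - max 7 (p - 5) + (max 7 (p - 5) - 7 + k) by omega,
          this]
        congr 1; omega)
    rw [this, pow_zero, Nat.div_one, Nat.mod_eq_of_lt (suf_lt _)]
  · rw [e4]
    have := window_eq (suf (w j) + 4 ^ 7 * blk w f (j + 1)) (blk w f j)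
      (p - 1 + 8 - max 7 (p - 5)) (54 - max 7 (p - 5)) (max 7 (p - 5)) (by
        intro k hk
        rw [← g.Wd_sufb j _ (by omega), ← Wd_eq j _ (by omega)]
        have := H k hk
        rw [show 54 * j + (54 - max 7 (p - 5) + k) = 54 * (j + 1) - max 7 (p - 5) + k by omega,
          this]
        congr 1; omega)
    rw [this, Nat.mod_eq_of_lt]
    rw [Nat.div_lt_iff_lt_mul (by positivity), ← pow_add,
      show max 7 (p - 5) + (54 - max 7 (p - 5)) = 54 by omega]
    exact g.blk_lt j

theorem FN1 {w f : ℕ → ℕ} (g : Good w f) (j j' d : ℕ) (hd : 0 < d) (hd' : d < 7)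
    (H : ∀ k < 5, Wd w f (54 * (j' + 1) + k) = Wd w f (54 * (j + 1) - d + k)) : False := by
  rcases check_n1 _ (g.lt j) _ (g.lt (j + 1)) _ (g.lt (j' + 1)) (d - 1) (by omega) with h | h
  · exact g.ne j h
  · apply h
    have := window_eq (suf (w j) + 4 ^ 7 * pre (w (j + 1))) (pre (w (j' + 1)))
      (6 - (d - 1)) 0 5 (by
        intro k hk
        rw [← g.Wd_sufpre j _ (by omega), zero_add, ← g.Wd_pre (j' + 1) k hk, H k hk]
        congr 1; omega)
    rw [this, pow_zero, Nat.div_one, Nat.mod_eq_of_lt (pre_lt _)]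

theorem FN2 {w f : ℕ → ℕ} (g : Good w f) (j j' d : ℕ) (hd : 0 < d) (hd' : d < 5)
    (H : ∀ k < 7, Wd w f (54 * j' + 47 + k) = Wd w f (54 * j + 47 + d + k)) : False := by
  rcases check_n2 _ (g.lt j) _ (g.lt (j + 1)) _ (g.lt j') (d - 1) (by omega) with h | h
  · exact g.ne j h
  · apply h
    have := window_eq (suf (w j) + 4 ^ 7 * pre (w (j + 1))) (suf (w j'))
      (d - 1 + 1) 0 7 (by
        intro k hk
        rw [← g.Wd_sufpre j _ (by omega), zero_add, ← g.Wd_suf j' k hk, H k hk]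
        congr 1; omega)
    rw [this, pow_zero, Nat.div_one, Nat.mod_eq_of_lt (suf_lt _)]

/-- Every square has a period that is a multiple of the block length. -/
theorem aligned {w f : ℕ → ℕ} (g : Good w f) (i p : ℕ) (hi : 54 ≤ i) (hp : 0 < p)
    (H : ∀ n, i ≤ n → n < i + p → Wd w f n = Wd w f (n + p)) : p % 54 = 0 := by
  by_contra hna
  have HA : ∀ j, ¬ (i + 7 ≤ 54 * (j + 1) ∧ 54 * (j + 1) + 5 ≤ i + p) := by
    rintro j ⟨h1, h2⟩
    apply g.F2 j (54 * (j + 1) + p) (by omega) (by omega)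
    intro k hk
    rw [H _ (by omega) (by omega)]
    congr 1; omega
  have HB : ∀ j, ¬ (i + p + 7 ≤ 54 * (j + 1) ∧ 54 * (j + 1) + 5 ≤ i + 2 * p) := by
    rintro j ⟨h1, h2⟩
    apply g.F2 j (54 * (j + 1) - p) (by omega) (by omega)
    intro k hk
    rw [H (54 * (j + 1) - p - 7 + k) (by omega) (by omega)]
    congr 1; omega
  by_cases hA : ∃ j, i + p < 54 * (j + 1) + 5 ∧ 54 * (j + 1) < i + p + 7
  · obtain ⟨j, hj1, hj2⟩ := hA
    by_cases hc : i + p ≤ 54 * (j + 1)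
    · -- the centre is left of the boundary
      obtain ⟨j, rfl⟩ : ∃ m, j = m + 1 := ⟨j - 1, by omega⟩
      have hj := HA j
      by_cases hs : i + 2 * p ≤ 54 * (j + 1 + 1) + 5
      · exact g.F1 j i p (by omega) hp (by omega) H
      · rcases lt_trichotomy p 54 with h | h | h
        · apply g.FR (j + 1) p hp h
          intro k hk
          rw [H (54 * (j + 1 + 1) - p + k) (by omega) (by omega)]
          congr 1; omega
        · omega
        · apply g.FN1 j (j + 1) (p - 54) (by omega) (by omega)
          intro k hk
          rw [H (54 * (j + 1) - (p - 54) + k) (by omega) (by omega)]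
          congr 1; omega
    · have hj := HB (j + 1)
      by_cases hs : 54 * (j + 1) ≤ i + 7
      · exact g.F1 j i p (by omega) hp (by omega) H
      · rcases lt_trichotomy p 54 with h | h | h
        · apply g.FL j p hp h
          intro k hk
          exact H _ (by omega) (by omega)
        · omega
        · apply g.FN2 (j + 1) j (p - 54) (by omega) (by omega)
          intro k hk
          rw [H _ (by omega) (by omega)]
          congr 1; omega
  · obtain ⟨m, hm⟩ : ∃ m, (i + p) / 54 = m + 1 := ⟨(i + p) / 54 - 1, by omega⟩
    have h1 := HA m
    have h2 := HB (m + 1)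
    have h3 : ¬ (i + p < 54 * (m + 1) + 5 ∧ 54 * (m + 1) < i + p + 7) := fun h => hA ⟨_, h⟩
    have h4 : ¬ (i + p < 54 * (m + 1 + 1) + 5 ∧ 54 * (m + 1 + 1) < i + p + 7) :=
      fun h => hA ⟨_, h⟩
    exact g.F1 m i p (by omega) hp (by omega) H

/-- A square in the coded word yields a square in `w`. -/
theorem square_down {w f : ℕ → ℕ} (g : Good w f) (i p : ℕ) (hi : 54 ≤ i) (hp : 0 < p)
    (H : ∀ n, i ≤ n → n < i + p → Wd w f n = Wd w f (n + p)) :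
    ∃ e r, 1 ≤ e ∧ 0 < r ∧ 54 * (e + 2 * r - 1) < i + 2 * p ∧
      ∀ k < r, w (e + k) = w (e + k + r) := by
  have h54 := g.aligned i p hi hp H
  refine ⟨(i + 53) / 54, p / 54, by omega, by omega, by omega, ?_⟩
  intro k hk
  apply pre_inj _ (g.lt _) _ (g.lt _)
  rw [← g.Wd_pre _ 0 (by norm_num), ← g.Wd_pre _ 0 (by norm_num), H _ (by omega) (by omega)]
  congr 1; omega

end Good
theorem sf_iff (v : List (Fin 3)) : SquareFree v ↔ ∀ i p, 0 < p → i + 2 * p ≤ v.length →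
    ¬ ∀ k < p, v.getD (i + k) 0 = v.getD (i + k + p) 0 := by
  constructor
  · intro h i p hp hip H
    have hy : (v.drop i).take p = (v.drop (i + p)).take p := by
      apply List.ext_getElem
      · simp; omega
      · intro k h1 h2
        have hk : k < p := by simp at h1; omega
        have := H k hk
        rw [List.getD_eq_getElem _ _ (by omega), List.getD_eq_getElem _ _ (by omega)] at this
        simp only [List.getElem_take, List.getElem_drop]
        rw [this]; congr 1; omega
    have := h (v.take i) ((v.drop i).take p) (v.drop (i + 2 * p)) (by
      have e1 : v = v.take i ++ v.drop i := (List.take_append_drop i v).symm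
      have e2 : v.drop i = (v.drop i).take p ++ v.drop (i + p) := by
        conv_lhs => rw [← List.take_append_drop p (v.drop i)]
        rw [List.drop_drop]
      have e3 : v.drop (i + p) = (v.drop (i + p)).take p ++ v.drop (i + 2 * p) := by
        conv_lhs => rw [← List.take_append_drop p (v.drop (i + p))]
        rw [List.drop_drop]; congr 2; omega
      conv_lhs => rw [e1, e2, e3, ← hy]
      simp [List.append_assoc])
    have hl := congrArg List.length this
    simp at hl; omega
  · intro h x y z hv
    by_contra hy
    have hp : 0 < y.length := List.length_pos_iff.mpr hy
    apply h x.length y.length hp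
    · rw [hv]; simp; omega
    · intro k hk
      rw [hv]
      simp only [List.append_assoc]
      rw [List.getD_append_right _ _ _ _ (by omega), List.getD_append_right x _ _ _ (by omega),
        List.getD_append _ _ _ _ (by omega), List.getD_append_right _ _ _ _ (by omega),
        List.getD_append _ _ _ _ (by omega)]
      congr 1; omega

def blkL (b : ℕ) : List (Fin 3) := (List.range 54).map (fun k => Fin.ofNat 3 (dg b k))

theorem blkL_length (b : ℕ) : (blkL b).length = 54 := by simp [blkL]

theorem blkL_getD (b k : ℕ) (hk : k < 54) : (blkL b).getD k 0 = Fin.ofNat 3 (dg b k) := by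
  rw [List.getD_eq_getElem _ _ (by rw [blkL_length]; exact hk)]
  simp [blkL]

theorem blkL_count {x b : ℕ} (hx : x < 3) (hb : b ∈ wds x) (d : Fin 3) : (blkL b).count d = 18 := by
  obtain ⟨-, -, h3, h4⟩ := bs_spec hx hb
  rw [← h4 d.val d.isLt]
  unfold blkL List.count
  rw [List.countP_map, List.countP_map]
  apply List.countP_congr
  intro k hk
  have hk' := h3 k (List.mem_range.mp hk)
  simp only [Function.comp, beq_iff_eq, Fin.ext_iff, Fin.ofNat]
  rw [Nat.mod_eq_of_lt hk']

/-- The coded finite word. -/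
def word (wl : List (Fin 3)) (f : ℕ → ℕ) (m : ℕ) : List (Fin 3) :=
  (List.range m).flatMap (fun j => blkL ((wds (wl.getD j 0).val).getD (f j) 0))

theorem word_succ (wl : List (Fin 3)) (f : ℕ → ℕ) (m : ℕ) : word wl f (m + 1) =
    word wl f m ++ blkL ((wds (wl.getD m 0).val).getD (f m) 0) := by
  simp [word, List.range_succ]

theorem word_length (wl : List (Fin 3)) (f : ℕ → ℕ) (m : ℕ) : (word wl f m).length = 54 * m := by
  induction m with
  | zero => rfl
  | succ m ih => rw [word_succ, List.length_append, ih, blkL_length]; ring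

theorem word_getD (wl : List (Fin 3)) (f : ℕ → ℕ) (m j k : ℕ) (hj : j < m) (hk : k < 54) :
    (word wl f m).getD (54 * j + k) 0 =
      Fin.ofNat 3 (dg ((wds (wl.getD j 0).val).getD (f j) 0) k) := by
  induction m with
  | zero => omega
  | succ m ih =>
    rw [word_succ]
    rcases Nat.lt_succ_iff_lt_or_eq.mp hj with h | rfl
    · rw [List.getD_append _ _ _ _ (by rw [word_length]; omega), ih h]
    · rw [List.getD_append_right _ _ _ _ (by rw [word_length]; omega), word_length,
        show 54 * j + k - 54 * j = k by omega, blkL_getD _ _ hk]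

theorem getD_mem_wds (x : Fin 3) {c : ℕ} (hc : c < 112) : (wds x.val).getD c 0 ∈ wds x.val := by
  have h : c < (wds x.val).length := by rw [check_len _ x.isLt]; exact hc
  rw [List.getD_eq_getElem _ _ h]
  exact List.getElem_mem h

theorem word_count (wl : List (Fin 3)) (f : ℕ → ℕ) (hf : ∀ n, f n < 112) (m : ℕ) (d : Fin 3) :
    (word wl f m).count d = 18 * m := by
  induction m with
  | zero => rfl
  | succ m ih =>
    rw [word_succ, List.count_append, ih, blkL_count (wl.getD m 0).isLt (getD_mem_wds _ (hf m))]
    ring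

/-- Padding of a word to an infinite one. -/
def padW (wl : List (Fin 3)) : ℕ → ℕ
  | 0 => ((wl.getD 0 0).val + 1) % 3
  | n + 1 => if n < wl.length then (wl.getD n 0).val
      else ((wl.getD (wl.length - 1) 0).val + (n + 1 - wl.length)) % 3

def padF (f : ℕ → ℕ) : ℕ → ℕ
  | 0 => 0
  | n + 1 => f n

theorem pad_good (wl : List (Fin 3)) (f : ℕ → ℕ) (hf : ∀ n, f n < 112) (hl : 0 < wl.length)
    (hs : SquareFree wl) : Good (padW wl) (padF f) := by
  refine ⟨?_, ?_, ?_⟩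
  · intro n
    cases n with
    | zero => exact Nat.mod_lt _ (by norm_num)
    | succ n =>
      simp only [padW]
      split
      · exact (wl.getD n 0).isLt
      · exact Nat.mod_lt _ (by norm_num)
  · intro n
    cases n with
    | zero =>
      simp only [padW, hl, if_true]
      have := (wl.getD 0 0).isLt
      omega
    | succ n =>
      simp only [padW]
      by_cases h : n + 1 < wl.length
      · rw [if_pos (by omega), if_pos h]
        intro he
        apply (sf_iff wl).mp hs n 1 (by norm_num) (by omega)
        intro k hk
        obtain rfl : k = 0 := by omega
        exact Fin.ext he
      · rw [if_neg h]
        by_cases h' : n < wl.length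
        · rw [if_pos h', show wl.length - 1 = n by omega]
          have := (wl.getD n 0).isLt
          omega
        · rw [if_neg h']
          omega
  · intro n
    cases n with
    | zero => simp [padF]
    | succ n => exact hf n

theorem word_squareFree (wl : List (Fin 3)) (f : ℕ → ℕ) (hf : ∀ n, f n < 112) (hl : 0 < wl.length)
    (hs : SquareFree wl) : SquareFree (word wl f wl.length) := by
  have g := pad_good wl f hf hl hs
  have key : ∀ n < 54 * wl.length, (word wl f wl.length).getD n 0 =
      Fin.ofNat 3 (Wd (padW wl) (padF f) (n + 54)) ∧ Wd (padW wl) (padF f) (n + 54) < 3 := by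
    intro n hn
    have hj : n / 54 < wl.length := by omega
    have e : Wd (padW wl) (padF f) (n + 54) =
        dg ((wds (wl.getD (n / 54) 0).val).getD (f (n / 54)) 0) (n % 54) := by
      rw [show n + 54 = 54 * (n / 54 + 1) + n % 54 by omega, Good.Wd_eq _ _ (by omega)]
      simp only [blk, padW, padF, hj, if_true]
    refine ⟨?_, ?_⟩
    · rw [e, ← word_getD wl f wl.length (n / 54) (n % 54) hj (by omega)]
      congr 1; omega
    · rw [e]
      exact (bs_spec (wl.getD (n / 54) 0).isLt (getD_mem_wds _ (hf _))).2.2.1 _ (by omega)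
  rw [sf_iff]
  intro i p hp hip H
  rw [word_length] at hip
  obtain ⟨e, r, he, hr, hb, hk⟩ := g.square_down (i + 54) p (by omega) hp (by
    intro n h1 h2
    obtain ⟨n, rfl⟩ : ∃ m, n = m + 54 := ⟨n - 54, by omega⟩
    have h := H (n - i) (by omega)
    rw [show i + (n - i) = n by omega] at h
    obtain ⟨a1, b1⟩ := key n (by omega)
    obtain ⟨a2, b2⟩ := key (n + p) (by omega)
    rw [a1, a2, Fin.ext_iff] at h
    simp only [Fin.ofNat] at h
    rw [Nat.mod_eq_of_lt b1, Nat.mod_eq_of_lt b2] at h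
    rw [h]; congr 1; omega)
  apply (sf_iff wl).mp hs (e - 1) r hr (by omega)
  intro k hkr
  have := hk k hkr
  rw [show e + k = (e - 1 + k) + 1 by omega, show e - 1 + k + 1 + r = (e - 1 + k + r) + 1 by omega]
    at this
  simp only [padW] at this
  rw [if_pos (by omega), if_pos (by omega)] at this
  exact Fin.ext this

theorem exists_sf (N : ℕ) : ∃ wl : List (Fin 3), wl.length = 54 ^ N ∧ SquareFree wl := by
  induction N with
  | zero =>
    refine ⟨[0], rfl, ?_⟩
    rw [sf_iff]
    intro i p hp hip
    simp at hip; omega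
  | succ N ih =>
    obtain ⟨wl, hl, hs⟩ := ih
    refine ⟨word wl (fun _ => 0) wl.length, ?_, ?_⟩
    · rw [word_length, hl]; ring
    · exact word_squareFree wl _ (fun _ => by norm_num) (by rw [hl]; positivity) hs

theorem word_inj (wl : List (Fin 3)) (f h : ℕ → ℕ) (hf : ∀ n, f n < 112) (hh : ∀ n, h n < 112)
    (m : ℕ) (he : word wl f m = word wl h m) (j : ℕ) (hj : j < m) : f j = h j := by
  have hx := (wl.getD j 0).isLt
  have m1 := getD_mem_wds (wl.getD j 0) (hf j)
  have m2 := getD_mem_wds (wl.getD j 0) (hh j)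
  have hnum : (wds (wl.getD j 0).val).getD (f j) 0 = (wds (wl.getD j 0).val).getD (h j) 0 := by
    rw [← Nat.mod_eq_of_lt (wds_lt hx m1), ← Nat.mod_eq_of_lt (wds_lt hx m2)]
    apply window_eq_aux
    intro k hk
    have := congrArg (fun l => l.getD (54 * j + k) 0) he
    simp only [word_getD wl _ m j k hj hk, Fin.ext_iff, Fin.ofNat] at this
    rwa [Nat.mod_eq_of_lt ((bs_spec hx m1).2.2.1 k hk),
      Nat.mod_eq_of_lt ((bs_spec hx m2).2.2.1 k hk)] at this
  have l1 : f j < (wds (wl.getD j 0).val).length := by rw [check_len _ hx]; exact hf j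
  have l2 : h j < (wds (wl.getD j 0).val).length := by rw [check_len _ hx]; exact hh j
  rw [List.getD_eq_getElem _ _ l1, List.getD_eq_getElem _ _ l2] at hnum
  exact (check_nodup _ hx).getElem_inj_iff.mp hnum

/-- The words counted in the theorem. -/
def wset (δ : ℝ) (n : ℕ) : Type := {w : List (Fin 3) // w.length = n ∧ SquareFree w ∧
  ∀ x : Fin 3, |(w.count x : ℝ) - n / 3| ≤ δ * n}

def wset.toVec (δ : ℝ) (n : ℕ) (w : wset δ n) : List.Vector (Fin 3) n := ⟨w.1, w.2.1⟩

theorem wset_inj (δ : ℝ) (n : ℕ) : Function.Injective (wset.toVec δ n) := by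
  intro a b h
  have h' : a.1 = b.1 := congrArg (fun v : List.Vector (Fin 3) n => v.1) h
  exact Subtype.ext h'

instance wset_finite (δ : ℝ) (n : ℕ) : Finite (wset δ n) :=
  Finite.of_injective (wset.toVec δ n) (wset_inj δ n)

theorem wset_card_le (δ : ℝ) (n : ℕ) : Nat.card (wset δ n) ≤ 3 ^ n := by
  have := Nat.card_le_card_of_injective (wset.toVec δ n) (wset_inj δ n)
  rw [Nat.card_eq_fintype_card (α := List.Vector (Fin 3) n), card_vector] at this
  simpa using this

theorem wset_card_ge (δ : ℝ) (hδ : 0 < δ) (N : ℕ) :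
    112 ^ (54 ^ N) ≤ Nat.card (wset δ (54 * 54 ^ N)) := by
  obtain ⟨wl, hl, hs⟩ := exists_sf N
  let ext (c : Fin wl.length → Fin 112) : ℕ → ℕ :=
    fun n => if h : n < wl.length then (c ⟨n, h⟩).val else 0
  have hext : ∀ c n, ext c n < 112 := by
    intro c n
    simp only [ext]
    split
    · exact Fin.isLt _
    · norm_num
  let F : (Fin wl.length → Fin 112) → wset δ (54 * 54 ^ N) := fun c =>
    ⟨word wl (ext c) wl.length, by rw [word_length, hl],
      word_squareFree wl _ (hext c) (by rw [hl]; positivity) hs, by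
        intro x
        rw [word_count wl _ (hext c), hl]
        push_cast
        rw [show (18 * 54 ^ N - 54 * 54 ^ N / 3 : ℝ) = 0 by ring, abs_zero]
        positivity⟩
  have hF : Function.Injective F := by
    intro a b h
    have h1 : word wl (ext a) wl.length = word wl (ext b) wl.length := congrArg Subtype.val h
    funext j
    have := word_inj wl _ _ (hext a) (hext b) _ h1 j j.isLt
    simp only [ext, j.isLt, dite_true] at this
    exact Fin.ext this
  have := Nat.card_le_card_of_injective F hF
  have h2 : 112 ^ wl.length ≤ Nat.card (wset δ (54 * 54 ^ N)) := by simpa using this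
  rwa [hl] at h2

theorem log_bound : Real.log 39 / 42 ≤ Real.log 112 / 54 := by
  rw [div_le_div_iff₀ (by norm_num) (by norm_num)]
  have h : Real.log ((39 : ℝ) ^ 54) ≤ Real.log ((112 : ℝ) ^ 42) :=
    Real.log_le_log (by norm_num) (by norm_num)
  rw [Real.log_pow, Real.log_pow] at h
  push_cast at h
  linarith

/-- For every `δ > 0`, the number of ternary square-free words of length `n`
whose letter frequencies are all within `δ` of `1/3` grows at least as
`39^(n/42)`:
`limsup (1/n) log #{w : length n, square-free, |count_x(w) - n/3| ≤ δn ∀x}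
  ≥ (log 39)/42`. -/
theorem ternary_squareFree_equal_frequency_growth (δ : ℝ) (hδ : 0 < δ) :
    Real.log 39 / 42 ≤
      Filter.limsup (fun n : ℕ =>
        Real.log (Nat.card {w : List (Fin 3) // w.length = n ∧ SquareFree w ∧
          ∀ x : Fin 3, |(w.count x : ℝ) - n / 3| ≤ δ * n}) / n) Filter.atTop := by
  change Real.log 39 / 42 ≤ Filter.limsup (fun n : ℕ =>
    Real.log (Nat.card (wset δ n)) / n) Filter.atTop
  apply Filter.le_limsup_of_frequently_le
  · rw [Filter.frequently_atTop]
    intro a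
    refine ⟨54 * 54 ^ a, ?_, ?_⟩
    · have : a < 54 ^ a := Nat.lt_pow_self (by norm_num)
      omega
    · refine log_bound.trans ?_
      have hc : (112 : ℝ) ^ (54 ^ a) ≤ (Nat.card (wset δ (54 * 54 ^ a)) : ℝ) := by
        exact_mod_cast wset_card_ge δ hδ a
      have hlog := Real.log_le_log (by positivity) hc
      rw [Real.log_pow] at hlog
      rw [div_le_div_iff₀ (by norm_num) (by positivity)]
      push_cast at hlog ⊢
      nlinarith [hlog]
  · refine Filter.isBoundedUnder_of ⟨Real.log 3, ?_⟩
    intro n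
    rcases Nat.eq_zero_or_pos n with rfl | hn
    · simp only [Nat.cast_zero, div_zero]
      exact Real.log_nonneg (by norm_num)
    · have hn' : (0 : ℝ) < n := by exact_mod_cast hn
      rw [div_le_iff₀ hn']
      rcases Nat.eq_zero_or_pos (Nat.card (wset δ n)) with h0 | h0
      · rw [h0, Nat.cast_zero, Real.log_zero]
        have := Real.log_nonneg (show (1 : ℝ) ≤ 3 by norm_num)
        positivity
      · have h1 : (Nat.card (wset δ n) : ℝ) ≤ 3 ^ n := by exact_mod_cast wset_card_le δ n
        have := Real.log_le_log (by exact_mod_cast h0) h1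
        rw [Real.log_pow] at this
        linarith
end

section
/- For each frequency f in the set {16/51, 9/28, 28/87, 271/841, 31/96, 331/1024, 280/841, 341/1024, 1/3, 271/812, 11/32, 10/29, 6/17} and every δ > 0, limsup_{n→∞} (1/n) log #{ w : w is a ternary square-free word of length n with |count_a(w) − f·n| ≤ δn } > 0; that is, the number of ternary square-free words whose frequency of the letter a is approximately f grows exponentially in n. -/
namespace TSF

/-- The six blocks (length 29): for each letter a block with nine `0` and one with eleven `0`. -/
def blk : Fin 3 → Bool → List (Fin 3)
  | 0, false => [1,0,1,2,0,1,0,2,1,0,1,2,1,0,2,0,1,2,1,0,1,2,0,2,1,2,0,1,2]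
  | 1, false => [1,0,2,1,2,0,2,1,0,2,0,1,0,2,1,2,0,2,1,0,1,2,0,2,1,2,0,1,2]
  | 2, false => [1,0,1,2,0,1,0,2,1,2,0,2,1,0,1,2,1,0,2,0,1,2,0,2,1,2,0,1,2]
  | 0, true => [1,0,2,0,1,0,2,1,0,1,2,0,1,0,2,0,1,2,0,2,1,2,0,1,0,2,0,1,2]
  | 1, true => [1,0,2,0,1,0,2,1,2,0,1,0,2,0,1,2,1,0,1,2,0,1,0,2,0,1,2,0,2]
  | 2, true => [1,0,2,0,1,0,2,1,2,0,1,0,2,0,1,2,0,2,1,0,1,2,0,1,0,2,0,1,2]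

/-- The first `P` letters agree. -/
def pre : ℕ → List (Fin 3) → List (Fin 3) → Bool
  | 0, _, _ => true
  | P + 1, a :: l, b :: t => (a.val == b.val) && pre P l t
  | _ + 1, _, _ => false

/-- Base-four code of a word. -/
def enc : List (Fin 3) → ℕ
  | [] => 0
  | a :: l => a.val + 4 * enc l

/-- No square of half-length `P` (with `Q = 4 ^ P`), starting positions `< k`.
Written with recursors to keep kernel evaluation cheap. -/
def chkS (Q k : ℕ) : ℕ → ℕ → Bool :=
  Nat.rec (fun _ _ => true) (fun _ ih T U =>
    Bool.rec (ih (Nat.div T 4) (Nat.div U 4)) false (Nat.beq (Nat.mod T Q) (Nat.mod U Q))) k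

def chkP (T n : ℕ) : ℕ → ℕ → ℕ → Bool :=
  Nat.rec (fun _ _ _ => true) (fun _ ih k U Q =>
    Bool.rec false (ih (Nat.sub k 2) (Nat.div U 4) (Nat.mul Q 4)) (chkS Q k T U)) n

theorem chkS_of (Q k : ℕ) : ∀ s T U : ℕ, s < k → T / 4 ^ s % Q = U / 4 ^ s % Q →
    chkS Q k T U = false := by
  induction k with
  | zero => intro s T U hs; omega
  | succ k ih =>
    intro s T U hs h
    change Bool.rec (chkS Q k (T / 4) (U / 4)) false (Nat.beq (T % Q) (U % Q)) = false
    cases s with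
    | zero =>
      rw [pow_zero, Nat.div_one, Nat.div_one] at h
      have hb : Nat.beq (T % Q) (U % Q) = true := by rw [h]; simp
      rw [hb]
    | succ s =>
      rw [pow_succ', ← Nat.div_div_eq_div_mul, ← Nat.div_div_eq_div_mul] at h
      rw [ih s _ _ (by omega) h]
      cases Nat.beq (T % Q) (U % Q) <;> rfl

theorem chkP_of (T n : ℕ) : ∀ p s k U Q : ℕ, p < n → s + 2 * p < k →
    T / 4 ^ s % (Q * 4 ^ p) = U / 4 ^ p / 4 ^ s % (Q * 4 ^ p) → chkP T n k U Q = false := by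
  induction n with
  | zero => intro p s k U Q hp; omega
  | succ n ih =>
    intro p s k U Q hp hs h
    change Bool.rec false (chkP T n (k - 2) (U / 4) (Q * 4)) (chkS Q k T U) = false
    cases p with
    | zero =>
      rw [pow_zero, Nat.div_one, mul_one] at h
      rw [chkS_of Q k s T U (by omega) h]
    | succ p =>
      rw [pow_succ', ← Nat.div_div_eq_div_mul, ← mul_assoc] at h
      rw [ih p s (k - 2) _ _ (by omega) (by omega) h]
      cases chkS Q k T U <;> rfl

theorem enc_div (s : ℕ) : ∀ l : List (Fin 3), enc l / 4 ^ s = enc (l.drop s) := by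
  induction s with
  | zero => simp
  | succ s ih =>
    intro l
    cases l with
    | nil => simp [enc]
    | cons a l =>
      rw [pow_succ', ← Nat.div_div_eq_div_mul, List.drop_succ_cons, ← ih]
      congr 1
      simp only [enc]
      omega

theorem enc_mod (P : ℕ) : ∀ l t : List (Fin 3), P ≤ l.length → P ≤ t.length →
    (∀ i < P, l.getD i 0 = t.getD i 0) → enc l % 4 ^ P = enc t % 4 ^ P := by
  induction P with
  | zero => intros; simp [Nat.mod_one]
  | succ P ih =>
    intro l t hl ht h
    match l, t with
    | [], _ => simp at hl
    | _ :: _, [] => simp at ht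
    | a :: l, b :: t =>
      have h0 := h 0 (by omega)
      simp at h0
      have : enc l ≡ enc t [MOD 4 ^ P] := ih l t (by simpa using hl) (by simpa using ht)
        (fun i hi => by simpa using h (i + 1) (by omega))
      subst h0
      change a.val + 4 * enc l ≡ a.val + 4 * enc t [MOD 4 ^ (P + 1)]
      rw [pow_succ']
      exact Nat.ModEq.add_left _ (Nat.ModEq.mul_left' 4 this)

theorem pre_of (P : ℕ) : ∀ l t : List (Fin 3), P ≤ l.length → P ≤ t.length →
    (∀ i < P, l.getD i 0 = t.getD i 0) → pre P l t = true := by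
  induction P with
  | zero => intros; simp [pre]
  | succ P ih =>
    intro l t hl ht h
    match l, t with
    | [], _ => simp at hl
    | _ :: _, [] => simp at ht
    | a :: l, b :: t =>
      have h0 := h 0 (by omega)
      simp at h0
      have := ih l t (by simpa using hl) (by simpa using ht)
        (fun i hi => by simpa using h (i + 1) (by omega))
      simp [pre, h0, this]

theorem getD_drop (l : List (Fin 3)) (k i : ℕ) : (l.drop k).getD i 0 = l.getD (k + i) 0 := by
  simp [List.getD]

theorem chk_of (l : List (Fin 3)) (hl : l.length = 87) (s P : ℕ) (hP : 0 < P)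
    (hs : s + 2 * P ≤ 87) (h : ∀ i < P, l.getD (s + i) 0 = l.getD (s + P + i) 0) :
    chkP (enc l) 43 86 (enc l / 4) 4 = false := by
  obtain ⟨p, rfl⟩ : ∃ p, P = p + 1 := ⟨P - 1, by omega⟩
  apply chkP_of _ _ p s _ _ _ (by omega) (by omega)
  rw [← pow_succ', Nat.div_div_eq_div_mul (enc l) 4, ← pow_succ', enc_div, enc_div, enc_div, List.drop_drop]
  apply enc_mod
  · simp; omega
  · simp; omega
  · intro i hi
    rw [getD_drop, getD_drop, h i hi]
    congr 1; omega

set_option maxRecDepth 100000 in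
theorem c1 : ∀ a b c : Fin 3, a ≠ b → b ≠ c → ∀ x y z : Bool,
    chkP (enc (blk a x ++ (blk b y ++ blk c z))) 43 86
      (enc (blk a x ++ (blk b y ++ blk c z)) / 4) 4 = true := by
  decide +kernel

set_option maxRecDepth 100000 in
theorem c2 : ∀ a b c : Fin 3, b ≠ c → ∀ x y z : Bool, ∀ d : Fin 28,
    pre 29 (blk a x) ((blk b y ++ blk c z).drop (d.val + 1)) = false := by
  decide +kernel

theorem c3 : ∀ a b : Fin 3, a ≠ b → ∀ x y : Bool, pre 29 (blk a x) (blk b y) = false := by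
  decide +kernel

theorem c4 : ∀ a : Fin 3, pre 29 (blk a false) (blk a true) = false := by
  decide +kernel

theorem len : ∀ (a : Fin 3) (x : Bool), (blk a x).length = 29 := by decide +kernel

/-- Letter of a block. -/
def g (a : Fin 3 × Bool) (i : ℕ) : Fin 3 := (blk a.1 a.2).getD i 0

/-- The substituted sequence. -/
def W (u : ℕ → Fin 3 × Bool) (i : ℕ) : Fin 3 := g (u (i / 29)) (i % 29)

def SF (f : ℕ → Fin 3) (m : ℕ) : Prop :=
  ∀ s P, 0 < P → s + 2 * P ≤ m → ∃ i < P, f (s + i) ≠ f (s + P + i)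

theorem W_eq (u : ℕ → Fin 3 × Bool) (j i : ℕ) (h : i < 29) : W u (j * 29 + i) = g (u j) i := by
  unfold W
  rw [show (j * 29 + i) / 29 = j by omega, show (j * 29 + i) % 29 = i by omega]

theorem triple_get (a b c : Fin 3 × Bool) (j : ℕ) :
    (blk a.1 a.2 ++ (blk b.1 b.2 ++ blk c.1 c.2)).getD j 0 =
      if j < 29 then g a j else if j < 58 then g b (j - 29) else g c (j - 58) := by
  unfold g
  split_ifs with h1 h2
  · rw [List.getD_append _ _ _ _ (by rw [len]; exact h1)]
  · rw [List.getD_append_right _ _ _ _ (by rw [len]; omega), len,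
      List.getD_append _ _ _ _ (by rw [len]; omega)]
  · rw [List.getD_append_right _ _ _ _ (by rw [len]; omega), len,
      List.getD_append_right _ _ _ _ (by rw [len]; omega), len]
    congr 1

theorem pair_get (b c : Fin 3 × Bool) (j : ℕ) :
    (blk b.1 b.2 ++ blk c.1 c.2).getD j 0 = if j < 29 then g b j else g c (j - 29) := by
  unfold g
  split_ifs with h1
  · rw [List.getD_append _ _ _ _ (by rw [len]; exact h1)]
  · rw [List.getD_append_right _ _ _ _ (by rw [len]; omega), len]

theorem c1' (a b c : Fin 3 × Bool) (hab : a.1 ≠ b.1) (hbc : b.1 ≠ c.1) (s P : ℕ) (hP : 0 < P)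
    (hs : s + 2 * P ≤ 87)
    (h : ∀ i < P, (if s + i < 29 then g a (s + i) else if s + i < 58 then g b (s + i - 29)
        else g c (s + i - 58)) =
      (if s + P + i < 29 then g a (s + P + i) else if s + P + i < 58 then g b (s + P + i - 29)
        else g c (s + P + i - 58))) : False := by
  have := chk_of (blk a.1 a.2 ++ (blk b.1 b.2 ++ blk c.1 c.2)) (by simp [len]) s P hP
    hs (fun i hi => by rw [triple_get, triple_get]; exact h i hi)
  rw [c1 _ _ _ hab hbc] at this
  simp at this

theorem c2' (a b c : Fin 3 × Bool) (hbc : b.1 ≠ c.1) (d : ℕ) (hd : 0 < d) (hd' : d < 29)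
    (h : ∀ i < 29, g a i = if d + i < 29 then g b (d + i) else g c (d + i - 29)) : False := by
  have := pre_of 29 (blk a.1 a.2) ((blk b.1 b.2 ++ blk c.1 c.2).drop d) (by simp [len])
    (by simp [len]; omega) (fun i hi => by rw [getD_drop, pair_get]; exact h i hi)
  have h2 := c2 a.1 b.1 c.1 hbc a.2 b.2 c.2 ⟨d - 1, by omega⟩
  simp only [show d - 1 + 1 = d by omega] at h2
  rw [h2] at this
  simp at this

theorem c3' (a b : Fin 3 × Bool) (h : ∀ i < 29, g a i = g b i) : a.1 = b.1 := by
  by_contra hab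
  have := pre_of 29 (blk a.1 a.2) (blk b.1 b.2) (by simp [len]) (by simp [len]) h
  rw [c3 _ _ hab] at this
  simp at this

theorem c4' (a b : Fin 3 × Bool) (h1 : a.1 = b.1) (h : ∀ i < 29, g a i = g b i) : a = b := by
  obtain ⟨a, x⟩ := a
  obtain ⟨b, y⟩ := b
  simp only at h1
  subst h1
  cases x <;> cases y
  · rfl
  · have := pre_of 29 (blk a false) (blk a true) (by simp [len]) (by simp [len]) h
    rw [c4] at this
    simp at this
  · have := pre_of 29 (blk a false) (blk a true) (by simp [len]) (by simp [len])
      (fun i hi => (h i hi).symm)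
    rw [c4] at this
    simp at this
  · rfl

/-- A full block occurring at position `q` (inside the good range) is aligned. -/
theorem sync (u : ℕ → Fin 3 × Bool) (m : ℕ) (hadj : ∀ i, i + 2 ≤ m → (u i).1 ≠ (u (i + 1)).1)
    (a : Fin 3 × Bool) (p : ℕ) (hp : p + 29 ≤ m * 29)
    (h : ∀ i < 29, g a i = W u (p + i)) : p % 29 = 0 := by
  by_contra hne
  refine c2' a (u (p / 29)) (u (p / 29 + 1)) (hadj _ (by omega)) (p % 29) (by omega)
    (by omega) ?_
  intro i hi
  rw [h i hi]
  split_ifs with hc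
  · rw [← W_eq u _ _ hc]; congr 1; omega
  · rw [← W_eq u _ _ (by omega)]; congr 1; omega

theorem main (u : ℕ → Fin 3 × Bool) (m : ℕ) (hu : SF (fun i => (u i).1) (m + 2)) :
    SF (W u) (m * 29) := by
  have hadj : ∀ i, i + 2 ≤ m + 2 → (u i).1 ≠ (u (i + 1)).1 := by
    intro i hi
    obtain ⟨j, hj, h⟩ := hu i 1 (by omega) (by omega)
    obtain rfl : j = 0 := by omega
    simpa using h
  intro s P hP hs
  by_contra! hsq
  -- if some full block lies in one of the copies then the period is a multiple of 29
  have hcase : P % 29 = 0 ∨ (s + 2 * P ≤ (s / 29 + 3) * 29) := by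
    by_cases hA : ∃ j, s ≤ j * 29 ∧ (j + 1) * 29 ≤ s + P
    · left
      obtain ⟨j, h1, h2⟩ := hA
      have := sync u (m + 2) hadj (u j) (j * 29 + P) (by omega) (fun i hi => by
        rw [← W_eq u j i hi]
        have := hsq (j * 29 + i - s) (by omega)
        rw [show s + (j * 29 + i - s) = j * 29 + i by omega,
          show s + P + (j * 29 + i - s) = j * 29 + P + i by omega] at this
        exact this)
      omega
    by_cases hB : ∃ j, s + P ≤ j * 29 ∧ (j + 1) * 29 ≤ s + 2 * P
    · left
      obtain ⟨j, h1, h2⟩ := hB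
      have := sync u (m + 2) hadj (u j) (j * 29 - P) (by omega) (fun i hi => by
        rw [← W_eq u j i hi]
        have := hsq (j * 29 + i - s - P) (by omega)
        rw [show s + (j * 29 + i - s - P) = j * 29 - P + i by omega,
          show s + P + (j * 29 + i - s - P) = j * 29 + i by omega] at this
        exact this.symm)
      omega
    right
    push Not at hA hB
    have h1 := hA (s / 29 + 1) (by omega)
    have h2 := hB ((s + P) / 29 + 1) (by omega)
    by_cases he : (s + P) % 29 = 0
    · have h3 := hB ((s + P) / 29) (by omega)
      omega
    · omega
  by_cases hlong : P % 29 = 0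
  · -- aligned
    obtain ⟨k, rfl⟩ : ∃ k, P = k * 29 := ⟨P / 29, by omega⟩
    have hk : 0 < k := by omega
    obtain ⟨i, e, he, rfl⟩ : ∃ i e, e < 29 ∧ s = i * 29 + e := ⟨s / 29, s % 29, by omega, by omega⟩
    have key : ∀ t r, r < 29 → i * 29 + e ≤ t * 29 + r → t * 29 + r < i * 29 + e + k * 29 →
        g (u t) r = g (u (t + k)) r := by
      intro t r hr h1 h2
      have := hsq (t * 29 + r - (i * 29 + e)) (by omega)
      rw [show i * 29 + e + (t * 29 + r - (i * 29 + e)) = t * 29 + r by omega,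
        show i * 29 + e + k * 29 + (t * 29 + r - (i * 29 + e)) = (t + k) * 29 + r by omega,
        W_eq u _ _ hr, W_eq u _ _ hr] at this
      exact this
    have mid : ∀ t, i < t → t < i + k → (u t).1 = (u (t + k)).1 := by
      intro t h1 h2
      exact c3' _ _ (fun r hr => key t r hr (by omega) (by omega))
    have hi1 : (u i).1 ≠ (u (i + k)).1 := by
      intro heq
      obtain ⟨j, hj, h⟩ := hu i k hk (by omega)
      apply h
      rcases Nat.eq_zero_or_pos j with rfl | hj0
      · simpa using heq
      · have := mid (i + j) (by omega) (by omega)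
        simp only
        rw [this]; congr 2; omega
    have he0 : 0 < e := by
      by_contra h0
      exact hi1 (c3' _ _ (fun r hr => key i r hr (by omega) (by omega)))
    have hi2 : (u (i + k)).1 ≠ (u (i + k + k)).1 := by
      intro heq
      obtain ⟨j, hj, h⟩ := hu (i + 1) k hk (by omega)
      apply h
      simp only
      rcases Nat.lt_or_ge (j + 1) k with hj0 | hj0
      · have := mid (i + 1 + j) (by omega) (by omega)
        rw [this]; congr 2; omega
      · rw [show i + 1 + j = i + k by omega, show i + 1 + k + j = i + k + k by omega]
        exact heq
    refine c1' _ _ _ hi1 hi2 e 29 (by omega) (by omega) ?_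
    intro r hr
    rw [if_pos (show e + r < 58 by omega), if_neg (show ¬ (e + 29 + r < 29) by omega)]
    by_cases hc : e + r < 29
    · rw [if_pos hc, if_pos (by omega), key i (e + r) hc (by omega) (by omega)]
      congr 1; omega
    · rw [if_neg hc, if_neg (by omega), key (i + k) (e + r - 29) (by omega) (by omega) (by omega)]
      congr 1; omega
  · have hshort := hcase.resolve_left hlong
    have hget : ∀ j, j < 87 → W u (s / 29 * 29 + j) =
        if j < 29 then g (u (s / 29)) j else if j < 58 then g (u (s / 29 + 1)) (j - 29)
        else g (u (s / 29 + 1 + 1)) (j - 58) := by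
      intro j hj
      split_ifs with h1 h2
      · rw [W_eq u _ _ h1]
      · rw [← W_eq u _ _ (by omega)]; congr 1; omega
      · rw [← W_eq u _ _ (by omega)]; congr 1; omega
    refine c1' (u (s / 29)) (u (s / 29 + 1)) (u (s / 29 + 1 + 1)) (hadj _ (by omega))
      (hadj _ (by omega)) (s % 29) P hP (by omega) ?_
    intro i hi
    rw [← hget _ (by omega), ← hget _ (by omega)]
    have := hsq i hi
    rw [show s / 29 * 29 + (s % 29 + i) = s + i by omega,
      show s / 29 * 29 + (s % 29 + P + i) = s + P + i by omega]
    exact this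

theorem exists_SF (k : ℕ) : ∃ f, SF f (3 + k) := by
  induction k with
  | zero =>
    refine ⟨fun i => if i = 1 then 1 else 0, ?_⟩
    intro s P hP hs
    refine ⟨0, hP, ?_⟩
    obtain rfl : P = 1 := by omega
    obtain rfl | rfl : s = 0 ∨ s = 1 := by omega
    · simp
    · simp
  | succ k ih =>
    obtain ⟨f, hf⟩ := ih
    refine ⟨W (fun i => (f i, false)), ?_⟩
    have := main (fun i => (f i, false)) (k + 1) (by
      rw [show k + 1 + 2 = 3 + k by ring]; exact hf)
    intro s P hP hs
    exact this s P hP (by omega)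

/-- Prefix of a sequence as a list. -/
def pfx (f : ℕ → Fin 3) (n : ℕ) : List (Fin 3) := (List.range n).map f

theorem squareFree_pfx (f : ℕ → Fin 3) (n : ℕ) (h : SF f n) : SquareFree (pfx f n) := by
  intro x y z hw
  by_contra hy
  have hlen : n = x.length + y.length + y.length + z.length := by
    have := congrArg List.length hw
    simpa [pfx, add_assoc] using this
  obtain ⟨i, hi, hne⟩ := h x.length y.length (List.length_pos_iff.2 hy) (by omega)
  apply hne
  have e1 : ∀ j, j < n → (pfx f n)[j]? = some (f j) := by
    intro j hj; simp [pfx, hj]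
  have h1 := e1 (x.length + i) (by omega)
  have h2 := e1 (x.length + y.length + i) (by omega)
  rw [hw] at h1 h2
  have h1' : (x ++ y ++ y ++ z)[x.length + i]? = y[i]? := by
    rw [List.append_assoc, List.append_assoc, List.getElem?_append_right (by omega),
      List.getElem?_append_left (by omega)]
    congr 1; omega
  have h2' : (x ++ y ++ y ++ z)[x.length + y.length + i]? = y[i]? := by
    rw [List.append_assoc, List.append_assoc, List.getElem?_append_right (by omega),
      List.getElem?_append_right (by omega), List.getElem?_append_left (by omega)]
    congr 1; omega
  rw [h1'] at h1
  rw [h2', h1] at h2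
  exact Option.some.inj h2

theorem count_blk : ∀ (a : Fin 3) (x : Bool),
    ((List.range 29).map (g (a, x))).count 0 = if x then 11 else 9 := by decide +kernel

theorem count_pfx (u : ℕ → Fin 3 × Bool) (m : ℕ) : (pfx (W u) (m * 29)).count 0 =
    ∑ j ∈ Finset.range m, if (u j).2 then 11 else 9 := by
  induction m with
  | zero => simp [pfx]
  | succ m ih =>
    rw [Finset.sum_range_succ, ← ih, ← count_blk (u m).1]
    unfold pfx
    rw [show (m + 1) * 29 = m * 29 + 29 by ring, List.range_add, List.map_append, List.count_append,
      List.map_map]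
    congr 2
    apply List.map_congr_left
    intro i hi
    exact W_eq u m i (List.mem_range.1 hi)

theorem pfx_inj (f f' : ℕ → Fin 3) (n : ℕ) (h : pfx f n = pfx f' n) : ∀ i < n, f i = f' i := by
  intro i hi
  have := congrArg (fun l => l[i]?) h
  simpa [pfx, hi] using this

/-- Marks: `j*k` high blocks, then low blocks until `K*k`, then free choice. -/
def mark (K j k : ℕ) (c : Fin k → Bool) (i : ℕ) : Bool :=
  if i < j * k then true else if i < K * k then false else
    if h : i - K * k < k then c ⟨i - K * k, h⟩ else false

theorem count_mark (K j k : ℕ) (hj : j ≤ K) (c : Fin k → Bool) :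
    9 * (K + 1) * k + 2 * j * k ≤
      (∑ i ∈ Finset.range ((K + 1) * k), if mark K j k c i then 11 else 9) ∧
    (∑ i ∈ Finset.range ((K + 1) * k), if mark K j k c i then 11 else 9)
      ≤ 9 * (K + 1) * k + 2 * j * k + 2 * k := by
  obtain ⟨d, rfl⟩ := Nat.exists_eq_add_of_le hj
  have e : (j + d + 1) * k = j * k + d * k + k := by ring
  rw [e, Finset.sum_range_add, Finset.sum_range_add]
  have s1 : (∑ x ∈ Finset.range (j * k), if mark (j + d) j k c x then 11 else 9)
      = j * k * 11 := by
    rw [Finset.sum_congr rfl (g := fun _ => 11)]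
    · simp
    · intro x hx; simp [mark, Finset.mem_range.1 hx]
  have s2 : (∑ x ∈ Finset.range (d * k), if mark (j + d) j k c (j * k + x) then 11 else 9)
      = d * k * 9 := by
    rw [Finset.sum_congr rfl (g := fun _ => 9)]
    · simp
    · intro x hx
      have := Finset.mem_range.1 hx
      simp [mark, add_mul, this]
  have s3 : ∀ v : ℕ → Bool, k * 9 ≤ (∑ x ∈ Finset.range k, if v x then 11 else 9) ∧
      (∑ x ∈ Finset.range k, if v x then 11 else 9) ≤ k * 11 := by
    intro v
    constructor
    · calc k * 9 = ∑ x ∈ Finset.range k, 9 := by simp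
        _ ≤ _ := Finset.sum_le_sum (fun i _ => by split_ifs <;> omega)
    · calc _ ≤ ∑ x ∈ Finset.range k, 11 := Finset.sum_le_sum (fun i _ => by split_ifs <;> omega)
        _ = _ := by simp
  have s3' := s3 (fun x => mark (j + d) j k c (j * k + d * k + x))
  rw [s1, s2]
  constructor <;> nlinarith [s3'.1, s3'.2]

abbrev Good (f δ : ℝ) (n : ℕ) := {w : List (Fin 3) // w.length = n ∧ SquareFree w ∧
          |(w.count 0 : ℝ) - f * n| ≤ δ * n}

def toVec (f δ : ℝ) (n : ℕ) (w : Good f δ n) : List.Vector (Fin 3) n := ⟨w.1, w.2.1⟩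

theorem toVec_inj (f δ : ℝ) (n : ℕ) : Function.Injective (toVec f δ n) := by
  intro a b h
  apply Subtype.ext
  exact congrArg List.Vector.toList h

instance (f δ : ℝ) (n : ℕ) : Finite (Good f δ n) := Finite.of_injective _ (toVec_inj f δ n)

theorem card_le (f δ : ℝ) (n : ℕ) : Nat.card (Good f δ n) ≤ 3 ^ n := by
  have := Nat.card_le_card_of_injective _ (toVec_inj f δ n)
  simpa [Nat.card_eq_fintype_card, card_vector] using this

theorem card_ge (f δ : ℝ) (K j k : ℕ) (hj : j ≤ K)
    (h1 : f * ((K + 1) * 29) - δ * ((K + 1) * 29) ≤ 9 * (K + 1) + 2 * j)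
    (h2 : 9 * (K + 1) + 2 * j + 2 ≤ f * ((K + 1) * 29) + δ * ((K + 1) * 29)) :
    2 ^ k ≤ Nat.card (Good f δ ((K + 1) * k * 29)) := by
  obtain ⟨v, hv⟩ := exists_SF ((K + 1) * k)
  let u : (Fin k → Bool) → ℕ → Fin 3 × Bool := fun c i => (v i, mark K j k c i)
  have hgood : ∀ c, SquareFree (pfx (W (u c)) ((K + 1) * k * 29)) := by
    intro c
    apply squareFree_pfx
    apply main
    intro s P hP hs
    exact hv s P hP (by omega)
  have hcount : ∀ c, |((pfx (W (u c)) ((K + 1) * k * 29)).count 0 : ℝ)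
      - f * (((K + 1) * k * 29 : ℕ) : ℝ)| ≤ δ * (((K + 1) * k * 29 : ℕ) : ℝ) := by
    intro c
    rw [count_pfx]
    obtain ⟨b1, b2⟩ := count_mark K j k hj c
    change 9 * (K + 1) * k + 2 * j * k ≤
      (∑ i ∈ Finset.range ((K + 1) * k), if (u c i).2 then 11 else 9) at b1
    change (∑ i ∈ Finset.range ((K + 1) * k), if (u c i).2 then 11 else 9) ≤ _ at b2
    generalize (∑ i ∈ Finset.range ((K + 1) * k), if (u c i).2 then 11 else 9) = S at b1 b2
    have b1' : (9 * (K + 1) * k + 2 * j * k : ℝ) ≤ S := by exact_mod_cast b1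
    have b2' : (S : ℝ) ≤ (9 * (K + 1) * k + 2 * j * k + 2 * k : ℝ) := by exact_mod_cast b2
    have hk : (0 : ℝ) ≤ k := Nat.cast_nonneg k
    have m1 := mul_le_mul_of_nonneg_right h1 hk
    have m2 := mul_le_mul_of_nonneg_right h2 hk
    rw [abs_le]
    push_cast
    constructor <;> nlinarith
  let F : (Fin k → Bool) → Good f δ ((K + 1) * k * 29) := fun c =>
    ⟨pfx (W (u c)) ((K + 1) * k * 29), by simp [pfx], hgood c, hcount c⟩
  have hF : Function.Injective F := by
    intro c c' h
    have h' := pfx_inj _ _ _ (congrArg Subtype.val h)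
    funext r
    have hr := r.2
    have hlt : K * k + r.1 < (K + 1) * k := by rw [add_mul]; omega
    have := c4' (u c (K * k + r.1)) (u c' (K * k + r.1)) rfl (fun i hi => by
      rw [← W_eq _ _ _ hi, ← W_eq _ _ _ hi]
      exact h' _ (by omega))
    have h3 := congrArg Prod.snd this
    have hjk : j * k ≤ K * k := Nat.mul_le_mul_right k hj
    simpa [u, mark, show ¬ (K * k + r.1 < j * k) by omega] using h3
  have := Nat.card_le_card_of_injective F hF
  simpa [Nat.card_eq_fintype_card] using this

theorem growth (f : ℝ) (hf1 : 9 / 29 ≤ f) (hf2 : f ≤ 11 / 29) (δ : ℝ) (hδ : 0 < δ) :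
    0 < Filter.limsup (fun n : ℕ => Real.log (Nat.card (Good f δ n)) / n) Filter.atTop := by
  obtain ⟨K, hK⟩ := exists_nat_gt (4 / (29 * δ))
  have hK' : 4 < K * (29 * δ) := by rwa [div_lt_iff₀ (by positivity)] at hK
  have hK0 : (0 : ℝ) ≤ K := Nat.cast_nonneg K
  set t : ℝ := (29 * f - 9) / 2 with ht
  have ht0 : 0 ≤ t := by rw [ht]; linarith
  have ht1 : t ≤ 1 := by rw [ht]; linarith
  have hft : f * 29 = 9 + 2 * t := by rw [ht]; ring
  set j := ⌊t * K⌋₊ with hjdef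
  have hj1 : (j : ℝ) ≤ t * K := Nat.floor_le (by positivity)
  have hj2 : t * K < j + 1 := Nat.lt_floor_add_one _
  have hj : j ≤ K := by
    have : (j : ℝ) ≤ K := hj1.trans (by nlinarith)
    exact_mod_cast this
  have hcard : ∀ k, 2 ^ k ≤ Nat.card (Good f δ ((K + 1) * k * 29)) := by
    intro k
    apply card_ge f δ K j k hj
    · rw [show f * ((K + 1) * 29 : ℝ) = (f * 29) * (K + 1) by ring, hft]
      nlinarith
    · rw [show f * ((K + 1) * 29 : ℝ) = (f * 29) * (K + 1) by ring, hft]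
      nlinarith
  have hpos : 0 < Real.log 2 / ((K + 1) * 29) := by
    have := Real.log_pos (show (1 : ℝ) < 2 by norm_num)
    positivity
  refine lt_of_lt_of_le hpos ?_
  apply Filter.le_limsup_of_frequently_le
  · rw [Filter.frequently_atTop]
    intro N
    refine ⟨(K + 1) * (N + 1) * 29, by nlinarith [Nat.zero_le K, Nat.zero_le N], ?_⟩
    have h2 : ((2 : ℝ) ^ (N + 1)) ≤ Nat.card (Good f δ ((K + 1) * (N + 1) * 29)) := by
      exact_mod_cast hcard (N + 1)
    have h3 := Real.log_le_log (by positivity) h2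
    rw [Real.log_pow] at h3
    push_cast at h3 ⊢
    rw [div_le_div_iff₀ (by positivity) (by positivity)]
    have h4 := mul_le_mul_of_nonneg_right h3 (show (0 : ℝ) ≤ (K + 1) * 29 by positivity)
    calc _ = ((N : ℝ) + 1) * Real.log 2 * ((K + 1) * 29) := by ring
      _ ≤ _ := h4
  · refine Filter.isBoundedUnder_of ⟨Real.log 3, fun n => ?_⟩
    rcases Nat.eq_zero_or_pos n with rfl | hn
    · simpa using Real.log_nonneg (by norm_num : (1 : ℝ) ≤ 3)
    have hn' : (0 : ℝ) < n := by exact_mod_cast hn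
    rw [div_le_iff₀ hn']
    rcases Nat.eq_zero_or_pos (Nat.card (Good f δ n)) with h0 | h0
    · rw [h0]; simp; exact mul_nonneg (Real.log_nonneg (by norm_num)) hn'.le
    have h1 : (Nat.card (Good f δ n) : ℝ) ≤ 3 ^ n := by exact_mod_cast card_le f δ n
    have h2 := Real.log_le_log (by exact_mod_cast h0) h1
    rw [Real.log_pow] at h2
    linarith

end TSF

/-- For each frequency `f` in the given list and every `δ > 0`, the number of
ternary square-free words of length `n` whose frequency of the letter `a`
(here the letter `0 : Fin 3`) is within `δ` of `f` grows exponentially in `n`. -/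
theorem ternary_squareFree_fixed_frequency_growth (f : ℝ)
    (hf : f ∈ ({16/51, 9/28, 28/87, 271/841, 31/96, 331/1024, 280/841, 341/1024,
      1/3, 271/812, 11/32, 10/29, 6/17} : Set ℝ))
    (δ : ℝ) (hδ : 0 < δ) :
    0 < Filter.limsup (fun n : ℕ =>
        Real.log (Nat.card {w : List (Fin 3) // w.length = n ∧ SquareFree w ∧
          |(w.count 0 : ℝ) - f * n| ≤ δ * n}) / n) Filter.atTop := by
  have h : 9 / 29 ≤ f ∧ f ≤ 11 / 29 := by
    simp only [Set.mem_insert_iff, Set.mem_singleton_iff] at hf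
    rcases hf with h | h | h | h | h | h | h | h | h | h | h | h | h <;> subst h <;> norm_num
  exact TSF.growth f h.1 h.2 δ hδ
end
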